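/- arXiv:2210.09567 — 4 statements merged into one kernel-verified Lean document; each statement's English description precedes it below -/
import Mathlib

section
/- Let r(z) := (1 + z)(1 + z²) and S := {x + iy ∈ ℂ : −2/3 ≤ x ≤ 0, |y| ≤ 1/3}. Then |r(z)| ≤ 1 for every z ∈ S, and |r(z)| < 1 for every z ∈ S with z ≠ 0. -/
/-- The closed square `S = {x + iy : -2/3 ≤ x ≤ 0, |y| ≤ 1/3}`. -/
def Ssq : Set ℂ := {z : ℂ | -(2 / 3) ≤ z.re ∧ z.re ≤ 0 ∧ |z.im| ≤ 1 / 3}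

lemma aux_bound (a v : ℝ) (ha : 0 ≤ a) (ha2 : a ≤ 2 / 3) (hv : 0 ≤ v) (hv2 : v ≤ 1 / 9) :
    ((1 - a) ^ 2 + v) * ((1 + a ^ 2) ^ 2 - 2 * v * (1 - a ^ 2) + v ^ 2) ≤ 1 - v - a / 4 := by
  have h1 : 3 / 4 ≤ 1 - a + a ^ 2 := by nlinarith [sq_nonneg (a - 1 / 2)]
  have h2 : 4 / 3 ≤ 2 - a + a ^ 2 - a ^ 3 := by
    nlinarith [mul_nonneg (sq_nonneg a) (by linarith : 0 ≤ 1 - a)]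
  have h3 : 1 ≤ (1 - a + a ^ 2) * (2 - a + a ^ 2 - a ^ 3) := by nlinarith
  have h4 : 4 + 2 * a - 4 * a ^ 2 + 3 * a ^ 3 ≤ 6 := by
    nlinarith [mul_nonneg (sq_nonneg a) (by linarith : 0 ≤ 2 / 3 - a), sq_nonneg a]
  have h5 : v * a * (4 + 2 * a - 4 * a ^ 2 + 3 * a ^ 3) ≤ 2 / 3 * a := by
    have : v * a ≤ 1 / 9 * a := mul_le_mul_of_nonneg_right hv2 ha
    have h6 := mul_le_mul_of_nonneg_left h4 (mul_nonneg hv ha)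
    linarith
  have h6 : v ^ 2 * (v + (-1 - 2 * a + 3 * a ^ 2)) ≤ 0 := by
    apply mul_nonpos_of_nonneg_of_nonpos (sq_nonneg v)
    nlinarith
  have h7 := mul_le_mul_of_nonneg_left h3 ha
  have e : ((1 - a) ^ 2 + v) * ((1 + a ^ 2) ^ 2 - 2 * v * (1 - a ^ 2) + v ^ 2)
      = 1 - a * ((1 - a + a ^ 2) * (2 - a + a ^ 2 - a ^ 3)) - v
        + v * a * (4 + 2 * a - 4 * a ^ 2 + 3 * a ^ 3)
        + v ^ 2 * (v + (-1 - 2 * a + 3 * a ^ 2)) := by ring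
  rw [e]
  linarith

lemma aux_norm (z : ℂ) (hz : z ∈ Ssq) :
    ‖(1 + z) * (1 + z ^ 2)‖ ^ 2 ≤ 1 - z.im ^ 2 - (-z.re) / 4 := by
  obtain ⟨h1, h2, h3⟩ := hz
  have hv : z.im ^ 2 ≤ 1 / 9 := by
    rw [abs_le] at h3
    nlinarith [h3.1, h3.2]
  have h := aux_bound (-z.re) (z.im ^ 2) (by linarith) (by linarith) (sq_nonneg _) hv
  refine le_trans (le_of_eq ?_) h
  rw [← Complex.normSq_eq_norm_sq, Complex.normSq_mul, Complex.normSq_apply, Complex.normSq_apply]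
  simp only [pow_two, Complex.add_re, Complex.add_im, Complex.one_re, Complex.one_im, Complex.mul_re,
    Complex.mul_im]
  ring

theorem stmt_8 :
    (∀ z ∈ Ssq, ‖(1 + z) * (1 + z ^ 2)‖ ≤ 1) ∧
    (∀ z ∈ Ssq, z ≠ 0 → ‖(1 + z) * (1 + z ^ 2)‖ < 1) := by
  have key : ∀ z ∈ Ssq, z ≠ 0 → ‖(1 + z) * (1 + z ^ 2)‖ < 1 := by
    intro z hz h0
    have h := aux_norm z hz
    have hre : z.re ≤ 0 := hz.2.1
    have hpos : 0 < z.im ^ 2 + (-z.re) / 4 := by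
      by_cases hi : z.im = 0
      · have : z.re ≠ 0 := fun hr => h0 (Complex.ext hr hi)
        have : z.re < 0 := lt_of_le_of_ne hre this
        nlinarith [sq_nonneg z.im]
      · have : 0 < z.im ^ 2 := by positivity
        linarith
    by_contra hc
    push Not at hc
    nlinarith
  refine ⟨fun z hz => ?_, key⟩
  by_cases h0 : z = 0
  · simp [h0]
  · exact (key z hz h0).le
end

section
/- There exist constants δ₀ > 0 and c₂ > 0 such that for every real δ with 0 < δ ≤ δ₀ and every real v with |v| ≤ 1/3 + δ, setting z = δ + iv, one has |(1 + z)(1 + z²)|² ≤ 1 + c₂·δ. -/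
theorem stmt_9 : ∃ δ₀ c₂ : ℝ, 0 < δ₀ ∧ 0 < c₂ ∧
    ∀ δ v : ℝ, 0 < δ → δ ≤ δ₀ → |v| ≤ 1 / 3 + δ →
      ‖((1 + ((δ : ℂ) + (v : ℂ) * Complex.I)) *
        (1 + ((δ : ℂ) + (v : ℂ) * Complex.I) ^ 2))‖ ^ 2 ≤ 1 + c₂ * δ := by
  refine ⟨1 / 3, 100, by norm_num, by norm_num, ?_⟩
  intro δ v h0 h1 hv
  have e : ‖((1 + ((δ : ℂ) + (v : ℂ) * Complex.I)) *
        (1 + ((δ : ℂ) + (v : ℂ) * Complex.I) ^ 2))‖ ^ 2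
      = ((1 + δ) ^ 2 + v ^ 2) * ((1 + δ ^ 2 - v ^ 2) ^ 2 + 4 * δ ^ 2 * v ^ 2) := by
    rw [← Complex.normSq_eq_norm_sq, Complex.normSq_mul]
    simp [Complex.normSq_apply, pow_two, -mul_eq_mul_left_iff, -mul_eq_mul_right_iff]
    ring
  rw [e]
  have hw : v ^ 2 ≤ 1 := by
    rw [sq_le_one_iff_abs_le_one]; linarith
  have hw0 : 0 ≤ v ^ 2 := sq_nonneg v
  generalize v ^ 2 = w at hw hw0
  have hd : δ ^ 2 ≤ δ := by nlinarith
  have hd0 : 0 ≤ δ ^ 2 := sq_nonneg δ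
  have hA : (1 + δ) ^ 2 + w ≤ 1 + w + 3 * δ := by nlinarith
  have hB : (1 + δ ^ 2 - w) ^ 2 + 4 * δ ^ 2 * w ≤ (1 - w) ^ 2 + 7 * δ := by
    have h4 : δ ^ 2 * δ ^ 2 ≤ δ := by nlinarith
    have h5 : δ ^ 2 * w ≤ δ := by nlinarith
    have h6 : 0 ≤ δ ^ 2 * w := by positivity
    nlinarith
  have hB0 : 0 ≤ (1 + δ ^ 2 - w) ^ 2 + 4 * δ ^ 2 * w := by positivity
  have hC : (1 + w) * (1 - w) ^ 2 ≤ 1 := by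
    have : 0 ≤ w * (1 - w) := mul_nonneg hw0 (by linarith)
    nlinarith [mul_nonneg this hw0]
  have hD : (1 - w) ^ 2 ≤ 1 := by nlinarith
  calc _ ≤ (1 + w + 3 * δ) * ((1 - w) ^ 2 + 7 * δ) :=
        mul_le_mul hA hB hB0 (by positivity)
    _ = (1 + w) * (1 - w) ^ 2 + 7 * δ * (1 + w) + 3 * δ * (1 - w) ^ 2 + 21 * δ ^ 2 := by ring
    _ ≤ 1 + 100 * δ := by
      have h7 : δ * w ≤ δ := by nlinarith
      have h8 : δ * (1 - w) ^ 2 ≤ δ := by nlinarith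
      nlinarith
end

section
/- Let S := {x + iy ∈ ℂ : −2/3 ≤ x ≤ 0, |y| ≤ 1/3}. For every ε ∈ (0, 1) there exists c(ε) > 0 such that for every z ∈ S with dist(z, ∂S) ≥ ε/3, one has |(1 + z)(1 + z²)| ≤ e^{−c(ε)}. -/
/-- Polynomial bound in `a = -x`, `b = y²`. -/
theorem poly_bound (a b : ℝ) (ha : 0 ≤ a) (ha' : a ≤ 2 / 3) (hb : 0 ≤ b) (hb' : b ≤ 1 / 9) :
    ((1 - a) ^ 2 + b) * (1 + 2 * (a ^ 2 - b) + (a ^ 2 + b) ^ 2) ≤ 1 - a / 2 := by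
  have h1 : (a ^ 2 + b) ^ 2 ≤ a ^ 4 + 2 * b * a ^ 2 + b / 9 := by nlinarith
  have h2 : 0 ≤ (1 - a) ^ 2 + b := by positivity
  refine (mul_le_mul_of_nonneg_left (show _ ≤ (1 + a ^ 2) ^ 2 - b * (17 / 9 - 2 * a ^ 2) by
    nlinarith) h2).trans ?_
  have key0 : (1 - a) ^ 2 * (1 + a ^ 2) ^ 2 ≤ 1 - a / 2 - a * (1 / 2) := by
    have e1 : (1 - a) * (1 + a ^ 2) ≤ 1 - a * (3 / 4) := by nlinarith [mul_nonneg ha (sq_nonneg (a - 1 / 2))]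
    have e0 : 0 ≤ (1 - a) * (1 + a ^ 2) := mul_nonneg (by linarith) (by positivity)
    have : ((1 - a) * (1 + a ^ 2)) ^ 2 ≤ (1 - a * (3 / 4)) ^ 2 := by gcongr
    nlinarith
  have key1 : b * ((1 + a ^ 2) ^ 2 - (1 - a) ^ 2 * (17 / 9 - 2 * a ^ 2)) ≤ a * (1 / 2) := by
    have e : (1 + a ^ 2) ^ 2 - (1 - a) ^ 2 * (17 / 9 - 2 * a ^ 2) ≤ 9 / 2 * a := by
      have e2 : 0 ≤ a ^ 2 := by positivity
      have e3 : a ^ 2 ≤ 2 / 3 * a := by nlinarith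
      have e4 : a ^ 3 ≤ 4 / 9 * a := by nlinarith
      have e5 : a ^ 4 ≤ 8 / 27 * a := by nlinarith [mul_nonneg ha (sub_nonneg.2 ha')]
      nlinarith [mul_nonneg (sq_nonneg a) (sub_nonneg.2 ha'), mul_nonneg e2 (mul_nonneg ha (sub_nonneg.2 ha'))]
    nlinarith
  have : 0 ≤ b * b * (17 / 9 - 2 * a ^ 2) := by
    apply mul_nonneg (by positivity); nlinarith
  nlinarith

theorem stmt_10 : ∀ ε : ℝ, 0 < ε → ε < 1 → ∃ cε : ℝ, 0 < cε ∧
    ∀ z ∈ Ssq, ε / 3 ≤ Metric.infDist z (frontier Ssq) →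
      ‖(1 + z) * (1 + z ^ 2)‖ ≤ Real.exp (-cε) := by
  intro ε h0 _
  refine ⟨ε / 12, by linarith, fun z hz hd => ?_⟩
  obtain ⟨hx1, hx2, hy⟩ := hz
  have hw : (⟨0, z.im⟩ : ℂ) ∈ frontier Ssq := by
    refine ⟨subset_closure ⟨by norm_num, by norm_num, hy⟩, fun hi => ?_⟩
    have hsub : Ssq ⊆ {w : ℂ | w.re ≤ 0} := fun w hw => hw.2.1
    have := interior_mono hsub hi
    rw [Complex.interior_setOfPred_re_le] at this
    simp at this
  have hdist : dist z (⟨0, z.im⟩ : ℂ) = -z.re := by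
    rw [Complex.dist_of_im_eq (z := z) (w := ⟨0, z.im⟩) rfl, Real.dist_eq]
    simp [abs_of_nonpos hx2]
  have ha : ε / 3 ≤ -z.re := hdist ▸ hd.trans (Metric.infDist_le_dist_of_mem hw)
  have hb : z.im ^ 2 ≤ 1 / 9 := by
    have := abs_le.1 hy
    nlinarith
  have hP := poly_bound (-z.re) (z.im ^ 2) (by linarith) (by linarith) (by positivity) hb
  have hn : ‖(1 + z) * (1 + z ^ 2)‖ ^ 2 ≤ 1 - (-z.re) / 2 := by
    refine le_trans (le_of_eq ?_) hP
    rw [← Complex.normSq_eq_norm_sq, map_mul, Complex.normSq_apply, Complex.normSq_apply]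
    simp only [pow_two, Complex.add_re, Complex.add_im, Complex.mul_re, Complex.mul_im, Complex.one_re, Complex.one_im]
    ring
  have he : ‖(1 + z) * (1 + z ^ 2)‖ ^ 2 ≤ Real.exp (-(ε / 12)) ^ 2 := by
    have := Real.add_one_le_exp (-(ε / 6))
    rw [← Real.exp_nat_mul]
    have h3 : ((2 : ℕ) : ℝ) * -(ε / 12) = -(ε / 6) := by push_cast; ring
    rw [h3]
    linarith
  exact (sq_le_sq₀ (norm_nonneg _) (Real.exp_pos _).le).1 he
end

section
/- Let σ > 0 and Θ ∈ (0, π/2). For each integer n ≥ 2 define φ_n(z) := (z/(z + 1)) · ∏_{j=1}^{n−1} (z − e^{−σ j/√n})/(z + e^{−σ j/√n}). Then there exist a constant C > 0 and an integer n₀ (both depending only on σ and Θ) such that for every n ≥ n₀ and every z ∈ ℂ with |arg z| ≤ Θ and 2·e^{−σ(n−1)/√n} ≤ |z| ≤ 1, one has |φ_n(z)| ≤ e^{−C√n}. -/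
lemma aux_le_one (z : ℂ) (x : ℝ) (hz : 0 ≤ z.re) (hx : 0 < x) :
    ‖(z - (x : ℂ)) / (z + (x : ℂ))‖ ≤ 1 := by
  rw [norm_div]
  apply div_le_one_of_le₀ _ (norm_nonneg _)
  apply le_of_sq_le_sq _ (norm_nonneg _)
  rw [← Complex.normSq_eq_norm_sq, ← Complex.normSq_eq_norm_sq, Complex.normSq_apply,
    Complex.normSq_apply]
  simp
  nlinarith [mul_nonneg hz hx.le]

lemma aux_factor (z : ℂ) (x c : ℝ) (hc : 0 < c) (hre : ‖z‖ * c ≤ z.re) (hx : 0 < x)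
    (h1 : x ≤ ‖z‖) (h2 : ‖z‖ ≤ 2 * x) :
    ‖(z - (x : ℂ)) / (z + (x : ℂ))‖ ≤ Real.exp (-(c / 4)) := by
  have hz : 0 ≤ z.re := le_trans (by positivity) hre
  have hle : z.re ≤ ‖z‖ := Complex.re_le_norm z
  have hsq : ‖z‖ ^ 2 = z.re * z.re + z.im * z.im := by
    rw [← Complex.normSq_eq_norm_sq, Complex.normSq_apply]
  rw [norm_div]
  have hpos : 0 < ‖z + (x : ℂ)‖ := by
    rw [norm_pos_iff]
    intro h
    have := congrArg Complex.re h
    simp at this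
    linarith
  rw [div_le_iff₀ hpos]
  apply le_of_sq_le_sq _ (by positivity)
  rw [mul_pow, ← Real.exp_nat_mul]
  have he : 1 - c / 2 ≤ Real.exp (((2 : ℕ) : ℝ) * -(c / 4)) := by
    have := Real.add_one_le_exp (((2 : ℕ) : ℝ) * -(c / 4))
    push_cast at this ⊢
    linarith
  refine le_trans ?_ (mul_le_mul_of_nonneg_right he (sq_nonneg _))
  have e1 : ‖z - (x : ℂ)‖ ^ 2 = ‖z‖ ^ 2 + x ^ 2 - 2 * x * z.re := by
    rw [hsq, ← Complex.normSq_eq_norm_sq, Complex.normSq_apply]; simp; ring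
  have e2 : ‖z + (x : ℂ)‖ ^ 2 = ‖z‖ ^ 2 + x ^ 2 + 2 * x * z.re := by
    rw [hsq, ← Complex.normSq_eq_norm_sq, Complex.normSq_apply]; simp; ring
  rw [e1, e2]
  have a1 : x * (‖z‖ * c) ≤ x * z.re := mul_le_mul_of_nonneg_left hre hx.le
  have a2 : x * z.re ≤ x * ‖z‖ := mul_le_mul_of_nonneg_left hle hx.le
  have a3 : ‖z‖ ^ 2 + x ^ 2 + 2 * x * ‖z‖ ≤ 8 * (x * ‖z‖) := by nlinarith
  have a4 : c * (‖z‖ ^ 2 + x ^ 2 + 2 * x * z.re) ≤ c * (8 * (x * ‖z‖)) :=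
    mul_le_mul_of_nonneg_left (by linarith) hc.le
  nlinarith

theorem stmt_17 (σ Θ : ℝ) (hσ : 0 < σ) (hΘ1 : 0 < Θ) (hΘ2 : Θ < Real.pi / 2) :
    ∃ (C : ℝ) (n₀ : ℕ), 0 < C ∧ 2 ≤ n₀ ∧
      ∀ n : ℕ, n₀ ≤ n → ∀ z : ℂ, |Complex.arg z| ≤ Θ →
        2 * Real.exp (-σ * ((n : ℝ) - 1) / Real.sqrt n) ≤ ‖z‖ →
        ‖z‖ ≤ 1 →
        ‖z / (z + 1) * ∏ j ∈ Finset.Icc 1 (n - 1),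
          (z - (Real.exp (-σ * (j : ℝ) / Real.sqrt n) : ℂ)) /
          (z + (Real.exp (-σ * (j : ℝ) / Real.sqrt n) : ℂ))‖ ≤
        Real.exp (-C * Real.sqrt n) := by
  have hc : 0 < Real.cos Θ := Real.cos_pos_of_mem_Ioo ⟨by linarith, hΘ2⟩
  have hl : 0 < Real.log 2 := Real.log_pos (by norm_num)
  refine ⟨Real.cos Θ * Real.log 2 / (8 * σ), ⌈(2 * σ / Real.log 2) ^ 2⌉₊ + 2, by positivity,
    by omega, ?_⟩
  intro n hn z harg hz1 hz2
  set c := Real.cos Θ with hcdef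
  have hn2 : 2 ≤ n := by omega
  have hnpos : (0 : ℝ) < n := by positivity
  set s := Real.sqrt n with hs
  have hspos : 0 < s := Real.sqrt_pos.mpr hnpos
  have hr : 0 < ‖z‖ := lt_of_lt_of_le (by positivity) hz1
  have hsl : 2 * σ / Real.log 2 ≤ s := by
    apply Real.le_sqrt_of_sq_le
    refine (Nat.le_ceil _).trans ?_
    exact_mod_cast (by omega)
  have hre : ‖z‖ * c ≤ z.re := by
    rw [← Complex.norm_mul_cos_arg z]
    apply mul_le_mul_of_nonneg_left _ hr.le
    rw [← Real.cos_abs z.arg]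
    exact Real.cos_le_cos_of_nonneg_of_le_pi (abs_nonneg _) (by linarith) harg
  have hz0 : 0 ≤ z.re := le_trans (by positivity) hre
  set T := s * (-Real.log ‖z‖) / σ with hT
  set L := s * Real.log 2 / σ with hL
  have hT0 : 0 ≤ T := by
    have := Real.log_nonpos hr.le hz2
    have : 0 ≤ -Real.log ‖z‖ := by linarith
    positivity
  have hL2 : 2 ≤ L := by
    rw [hL, le_div_iff₀ hσ]
    rwa [div_le_iff₀ hl] at hsl
  have hTL : T + L ≤ (n : ℝ) - 1 := by
    have h := Real.log_le_log (by positivity) hz1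
    rw [Real.log_mul (by norm_num) (Real.exp_ne_zero _), Real.log_exp] at h
    have h' : Real.log 2 - Real.log ‖z‖ ≤ σ * ((n : ℝ) - 1) / s := by
      have : -σ * ((n : ℝ) - 1) / s = -(σ * ((n : ℝ) - 1) / s) := by ring
      linarith
    rw [le_div_iff₀ hspos] at h'
    rw [hT, hL, ← add_div, div_le_iff₀ hσ]
    linarith
  set S := Finset.Icc (⌊T⌋₊ + 1) ⌊T + L⌋₊ with hS
  have hsub : S ⊆ Finset.Icc 1 (n - 1) := by
    apply Finset.Icc_subset_Icc (by omega)
    apply Nat.floor_le_of_le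
    rw [Nat.cast_sub (by omega)]
    simpa using hTL
  have hcard : L - 1 ≤ (S.card : ℝ) := by
    rw [hS, Nat.card_Icc]
    have h1 := Nat.floor_le hT0
    have h2 := Nat.lt_floor_add_one (T + L)
    have h3 : (⌊T + L⌋₊ : ℝ) ≤ ((⌊T + L⌋₊ + 1 - (⌊T⌋₊ + 1) : ℕ) : ℝ) + ⌊T⌋₊ := by
      exact_mod_cast (by omega)
    linarith
  have hfac : ∀ j ∈ S, ‖(z - (Real.exp (-σ * (j : ℝ) / s) : ℂ)) /
          (z + (Real.exp (-σ * (j : ℝ) / s) : ℂ))‖ ≤ Real.exp (-(c / 4)) := by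
    intro j hj
    rw [hS, Finset.mem_Icc] at hj
    have hj1 : T ≤ j := by
      have := Nat.lt_floor_add_one T
      have h : ((⌊T⌋₊ + 1 : ℕ) : ℝ) ≤ j := by exact_mod_cast hj.1
      push_cast at h
      linarith
    have hj2 : (j : ℝ) ≤ T + L := by
      have h : (j : ℝ) ≤ ⌊T + L⌋₊ := by exact_mod_cast hj.2
      exact h.trans (Nat.floor_le (by linarith))
    rw [hT, div_le_iff₀ hσ] at hj1
    rw [hT, hL, ← add_div, le_div_iff₀ hσ] at hj2
    apply aux_factor z _ c hc hre (Real.exp_pos _)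
    · rw [← Real.le_log_iff_exp_le hr, div_le_iff₀ hspos]
      linarith
    · rw [← div_le_iff₀' (by norm_num), ← Real.log_le_iff_le_exp (by positivity),
        Real.log_div hr.ne' (by norm_num), le_div_iff₀ hspos]
      linarith
  rw [norm_mul, norm_prod]
  have hfirst : ‖z / (z + 1)‖ ≤ 1 := by
    rw [norm_div]
    apply div_le_one_of_le₀ _ (norm_nonneg _)
    apply le_of_sq_le_sq _ (norm_nonneg _)
    rw [← Complex.normSq_eq_norm_sq, ← Complex.normSq_eq_norm_sq, Complex.normSq_apply,
      Complex.normSq_apply]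
    simp
    nlinarith
  have hprod : ∏ j ∈ Finset.Icc 1 (n - 1), ‖(z - (Real.exp (-σ * (j : ℝ) / s) : ℂ)) /
          (z + (Real.exp (-σ * (j : ℝ) / s) : ℂ))‖ ≤ Real.exp (-(c / 4)) ^ S.card := by
    calc _ ≤ ∏ j ∈ Finset.Icc 1 (n - 1), (if j ∈ S then Real.exp (-(c / 4)) else 1) := by
          apply Finset.prod_le_prod (fun _ _ => norm_nonneg _)
          intro j _
          split_ifs with h
          · exact hfac j h
          · exact aux_le_one z _ hz0 (Real.exp_pos _)
      _ = _ := by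
          rw [Finset.prod_ite_mem, Finset.inter_eq_right.mpr hsub, Finset.prod_const]
  calc _ ≤ 1 * Real.exp (-(c / 4)) ^ S.card :=
        mul_le_mul hfirst hprod (Finset.prod_nonneg fun _ _ => norm_nonneg _) zero_le_one
    _ = Real.exp (S.card * -(c / 4)) := by rw [one_mul, ← Real.exp_nat_mul]
    _ ≤ _ := by
        apply Real.exp_le_exp.mpr
        have : -(c * Real.log 2 / (8 * σ)) * s = - (c / 8 * L) := by
          rw [hL]; field_simp
        rw [this]
        nlinarith
end
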